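/- Let (V, Φ) be a 3-dimensional Banach–Minkowski space, H ⊆ V a 2-dimensional subspace such that Φ|_H is not a Euclidean norm, and ν ∈ V∖H; for α ∈ H* let π_α ∈ V* be the unique functional with π_α|_H = α and π_α(ν) = 1. Let U be a neighborhood of 0 in H* and L : U → Hom(H, V) a C^∞ map such that L(0) is the inclusion of H into V and, for all α ∈ U and v ∈ H, π_α(L(α)(v)) = 0 and Φ(L(α)(v)) = Φ(v). Let R : H* → Hom(H, V) be the derivative of L at 0. Then R(h)(v) = 0 for every h ∈ H* and every v ∈ H with h(v) = 0. -/

import Mathlib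

noncomputable section

def IsBanachMinkowski {V : Type*} [NormedAddCommGroup V] [NormedSpace ℝ V] (Φ : V → ℝ) : Prop :=
  Φ 0 = 0 ∧
  (∀ v : V, v ≠ 0 → 0 < Φ v) ∧
  (∀ t : ℝ, 0 ≤ t → ∀ v : V, Φ (t • v) = t * Φ v) ∧
  (∀ v w : V, Φ (v + w) ≤ Φ v + Φ w) ∧
  ContDiffOn ℝ (⊤ : ℕ∞) Φ {(0 : V)}ᶜ ∧
  (∀ v : V, v ≠ 0 → ∀ w : V, w ≠ 0 →
    0 < iteratedFDeriv ℝ 2 (fun u => Φ u ^ 2) v ![w, w])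

def IsEuclideanNorm {V : Type*} [NormedAddCommGroup V] [NormedSpace ℝ V] (Φ : V → ℝ) : Prop :=
  ∃ Q : QuadraticForm ℝ V, Q.PosDef ∧ ∀ v : V, Φ v ^ 2 = Q v

lemma euler (φ : ℝ × ℝ → ℝ) (hom : ∀ t : ℝ, 0 ≤ t → ∀ v, φ (t • v) = t * φ v)
    (v : ℝ × ℝ) (hd : DifferentiableAt ℝ φ v) : fderiv ℝ φ v v = φ v := by
  have h1 : HasDerivAt (fun t : ℝ => t • v) v 1 := by
    simpa using (hasDerivAt_id (1:ℝ)).smul_const v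
  have h2 : HasDerivAt (fun t : ℝ => φ (t • v)) (fderiv ℝ φ v v) 1 := by
    have h3 : HasFDerivAt φ (fderiv ℝ φ v) ((1:ℝ) • v) := by simpa using hd.hasFDerivAt
    exact h3.comp_hasDerivAt (1:ℝ) h1
  have h4 : HasDerivAt (fun t : ℝ => t * φ v) (φ v) 1 := by
    simpa using (hasDerivAt_id (1:ℝ)).mul_const (φ v)
  refine h2.unique (h4.congr_of_eventuallyEq ?_)
  filter_upwards [lt_mem_nhds (zero_lt_one : (0:ℝ) < 1)] with t ht
  exact hom t ht.le v

lemma core_degen (φ : ℝ × ℝ → ℝ) (pos : ∀ v, v ≠ 0 → 0 < φ v)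
    (hom : ∀ t : ℝ, 0 ≤ t → ∀ v, φ (t • v) = t * φ v)
    (sub : ∀ v w, φ (v + w) ≤ φ v + φ w)
    (hd : ∀ v, v ≠ 0 → DifferentiableAt ℝ φ v) (x0 y0 : ℝ) (h0 : (x0, y0) ≠ (0 : ℝ × ℝ))
    (u : ℝ × ℝ) (hM : ∀ v, v ≠ 0 → fderiv ℝ φ v ((y0 * v.1 - x0 * v.2) • u) = 0) : u = 0 := by
  by_contra hu
  have hl : y0 * u.1 - x0 * u.2 = 0 := by
    have := hM u hu
    rw [map_smul, euler φ hom u (hd u hu), smul_eq_mul] at this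
    exact (mul_eq_zero.1 this).resolve_right (pos u hu).ne'
  have hs : 0 < x0 ^ 2 + y0 ^ 2 := by
    by_contra hc
    apply h0
    have hx : x0 = 0 := by nlinarith [sq_nonneg x0, sq_nonneg y0]
    have hy : y0 = 0 := by nlinarith [sq_nonneg x0, sq_nonneg y0]
    rw [hx, hy]; rfl
  set w : ℝ × ℝ := (y0, -x0) with hw
  have hlw : ∀ t : ℝ, y0 * (w + t • u).1 - x0 * (w + t • u).2 = x0 ^ 2 + y0 ^ 2 := by
    intro t
    simp [hw]
    linear_combination t * hl
  have hne : ∀ t : ℝ, w + t • u ≠ 0 := by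
    intro t h
    have := hlw t
    rw [h] at this
    simp at this
    linarith
  have hder : ∀ t : ℝ, HasDerivAt (fun t : ℝ => φ (w + t • u)) 0 t := by
    intro t
    have h1 : HasDerivAt (fun t : ℝ => w + t • u) u t := by
      simpa using ((hasDerivAt_id t).smul_const u).const_add w
    have h2 := (hd _ (hne t)).hasFDerivAt.comp_hasDerivAt t h1
    have h3 := hM _ (hne t)
    rw [hlw t, map_smul, smul_eq_mul] at h3
    have h4 := (mul_eq_zero.1 h3).resolve_left hs.ne'
    rw [h4] at h2
    exact h2
  have hc : ∀ t : ℝ, φ (w + t • u) = φ w := by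
    intro t
    have := is_const_of_deriv_eq_zero (fun t => (hder t).differentiableAt) (fun t => (hder t).deriv) t 0
    simpa using this
  have hb : ∀ t : ℝ, 0 ≤ t → t * φ u ≤ φ w + φ (-w) := by
    intro t ht
    rw [← hom t ht, ← hc t]
    have := sub (w + t • u) (-w)
    simpa using this
  have hp := pos u hu
  have hw0 : 0 ≤ φ w + φ (-w) := by simpa using hb 0 le_rfl
  have := hb ((φ w + φ (-w) + 1) / φ u) (by positivity)
  rw [div_mul_cancel₀ _ hp.ne'] at this
  linarith

lemma core_nondeg (φ : ℝ × ℝ → ℝ) (pos : ∀ v, v ≠ 0 → 0 < φ v)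
    (hom : ∀ t : ℝ, 0 ≤ t → ∀ v, φ (t • v) = t * φ v)
    (hd : ∀ v, v ≠ 0 → DifferentiableAt ℝ φ v) (a b c d : ℝ)
    (hM : ∀ v : ℝ × ℝ, v ≠ 0 → fderiv ℝ φ v (a * v.1 + b * v.2, c * v.1 + d * v.2) = 0)
    (hq : ∀ v : ℝ × ℝ, v ≠ 0 → c * v.1 ^ 2 + (d - a) * (v.1 * v.2) - b * v.2 ^ 2 ≠ 0) :
    ∃ A B C : ℝ, ∀ v : ℝ × ℝ, φ v ^ 2 = A * v.1 ^ 2 + B * (v.1 * v.2) + C * v.2 ^ 2 := by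
  set q : ℝ × ℝ → ℝ := fun v => c * v.1 ^ 2 + (d - a) * (v.1 * v.2) - b * v.2 ^ 2 with hqd
  have hqder : ∀ v : ℝ × ℝ, ∃ q' : ℝ × ℝ →L[ℝ] ℝ, HasFDerivAt q q' v ∧
      ∀ w, q' w = 2 * c * v.1 * w.1 + (d - a) * (v.1 * w.2 + v.2 * w.1) - 2 * b * v.2 * w.2 := by
    intro v
    have h1 : HasFDerivAt (fun v : ℝ × ℝ => v.1) (ContinuousLinearMap.fst ℝ ℝ ℝ) v := hasFDerivAt_fst
    have h2 : HasFDerivAt (fun v : ℝ × ℝ => v.2) (ContinuousLinearMap.snd ℝ ℝ ℝ) v := hasFDerivAt_snd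
    refine ⟨_, (((h1.pow 2).const_mul c).add ((h1.mul h2).const_mul (d - a))).sub ((h2.pow 2).const_mul b), ?_⟩
    intro w
    simp
    ring
  set F : ℝ × ℝ → ℝ := fun v => φ v ^ 2 * (q v)⁻¹ with hF
  have hFder : ∀ v : ℝ × ℝ, v ≠ 0 → ∃ F' : ℝ × ℝ →L[ℝ] ℝ, HasFDerivAt F F' v ∧
      F' v = 0 ∧ F' (a * v.1 + b * v.2, c * v.1 + d * v.2) = - (a + d) * F v := by
    intro v hv
    obtain ⟨q', hq', hq'w⟩ := hqder v
    have hqv : q v ≠ 0 := hq v hv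
    have hv1 : q' v = 2 * q v := by rw [hq'w]; simp only [hqd]; ring
    have hv2 : q' (a * v.1 + b * v.2, c * v.1 + d * v.2) = (a + d) * q v := by
      rw [hq'w]; simp only [hqd]; ring
    have h := ((hd v hv).hasFDerivAt.pow 2).mul ((hasDerivAt_inv hqv).comp_hasFDerivAt v hq')
    refine ⟨_, h, ?_, ?_⟩
    · simp [euler φ hom v (hd v hv), hv1]
      field_simp
      ring
    · simp [hM v hv, hv2, hF]
      field_simp
      try ring
  have hFpos : ∀ v, v ≠ 0 → F v ≠ 0 := fun v hv =>
    mul_ne_zero (pow_ne_zero _ (pos v hv).ne') (inv_ne_zero (hq v hv))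
  have hcont : ContinuousOn F (Metric.sphere 0 1) := by
    intro v hv
    have : v ≠ 0 := by rintro rfl; simp at hv
    obtain ⟨F', h, -⟩ := hFder v this
    exact h.continuousAt.continuousWithinAt
  have hne : (Metric.sphere (0 : ℝ × ℝ) 1).Nonempty := NormedSpace.sphere_nonempty.2 zero_le_one
  obtain ⟨m, hm, hmax⟩ := (isCompact_sphere (0 : ℝ × ℝ) 1).exists_isMaxOn hne hcont
  have hm0 : m ≠ 0 := by rintro rfl; simp at hm
  have hFhom : ∀ t : ℝ, 0 < t → ∀ v, F (t • v) = F v := by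
    intro t ht v
    simp only [hF, hom t ht.le]
    have : q (t • v) = t ^ 2 * q v := by simp [hqd]; ring
    rw [this, mul_pow, ← div_eq_mul_inv, ← div_eq_mul_inv, mul_div_mul_left _ _ (pow_ne_zero 2 ht.ne')]
  have hopen : IsOpen ({0}ᶜ : Set (ℝ × ℝ)) := isOpen_compl_singleton
  have hloc : IsLocalMax F m := by
    filter_upwards [hopen.mem_nhds hm0] with v hv
    have hv : v ≠ 0 := hv
    have hn : 0 < ‖v‖ := norm_pos_iff.2 hv
    rw [← hFhom ‖v‖⁻¹ (inv_pos.2 hn) v]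
    apply hmax
    simp [norm_smul, hn.ne']
  have htr : a + d = 0 := by
    obtain ⟨F', h, -, h2⟩ := hFder m hm0
    rw [hloc.hasFDerivAt_eq_zero h] at h2
    have h3 : -(a + d) * F m = 0 := by simpa using h2.symm
    have := (mul_eq_zero.1 h3).resolve_right (hFpos m hm0)
    linarith
  have hzero : ∀ v : ℝ × ℝ, v ≠ 0 → HasFDerivAt F (0 : ℝ × ℝ →L[ℝ] ℝ) v := by
    intro v hv
    obtain ⟨F', h, h1, h2⟩ := hFder v hv
    have : F' = 0 := by
      refine ContinuousLinearMap.ext fun w => ?_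
      have hqv : q v ≠ 0 := hq v hv
      have e : q v • w = (w.1 * (c * v.1 + d * v.2) - w.2 * (a * v.1 + b * v.2)) • v
          + (v.1 * w.2 - v.2 * w.1) • (a * v.1 + b * v.2, c * v.1 + d * v.2) := by
        ext <;> simp [hqd] <;> ring
      have e2 := congrArg F' e
      rw [map_add, map_smul, map_smul, map_smul, h1, h2, htr] at e2
      simpa [hqv] using e2
    rwa [this] at h
  have hconst : ∀ v, v ≠ 0 → F v = F m := by
    intro v hv
    have hr : 1 < Module.rank ℝ (ℝ × ℝ) := by
      rw [rank_prod', Module.rank_self, one_add_one_eq_two]; exact Cardinal.one_lt_two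
    refine hopen.is_const_of_fderiv_eq_zero (𝕜 := ℝ) (isConnected_compl_singleton_of_one_lt_rank hr 0).isPreconnected ?_ ?_ hv hm0
    · intro v hv
      exact (hzero v hv).differentiableAt.differentiableWithinAt
    · intro v hv
      exact (hzero v hv).fderiv
  refine ⟨F m * c, F m * (d - a), - F m * b, ?_⟩
  intro v
  by_cases hv : v = 0
  · subst hv
    have := hom 0 le_rfl 0
    simp at this
    simp [this]
  · have h1 := hconst v hv
    have h2 : q v ≠ 0 := hq v hv
    have h3 : φ v ^ 2 = F m * q v := by rw [← h1]; simp only [hF]; field_simp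
    rw [h3]; simp only [hqd]; ring

lemma core_linear (φ : ℝ × ℝ → ℝ) (pos : ∀ v, v ≠ 0 → 0 < φ v)
    (hom : ∀ t : ℝ, 0 ≤ t → ∀ v, φ (t • v) = t * φ v)
    (sub : ∀ v w, φ (v + w) ≤ φ v + φ w)
    (hd : ∀ v, v ≠ 0 → DifferentiableAt ℝ φ v) (a b c d : ℝ)
    (hM : ∀ v : ℝ × ℝ, v ≠ 0 → fderiv ℝ φ v (a * v.1 + b * v.2, c * v.1 + d * v.2) = 0)
    (hne : ¬ ∃ A B C : ℝ, ∀ v : ℝ × ℝ, φ v ^ 2 = A * v.1 ^ 2 + B * (v.1 * v.2) + C * v.2 ^ 2) :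
    a = 0 ∧ b = 0 ∧ c = 0 ∧ d = 0 := by
  by_cases hq : ∀ v : ℝ × ℝ, v ≠ 0 → c * v.1 ^ 2 + (d - a) * (v.1 * v.2) - b * v.2 ^ 2 ≠ 0
  · exact absurd (core_nondeg φ pos hom hd a b c d hM hq) hne
  push Not at hq
  obtain ⟨⟨x, y⟩, hv, h⟩ := hq
  simp only at h
  have hs : x ^ 2 + y ^ 2 ≠ 0 := by
    intro hc
    apply hv
    have hx : x = 0 := by nlinarith [sq_nonneg x, sq_nonneg y]
    have hy : y = 0 := by nlinarith [sq_nonneg x, sq_nonneg y]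
    rw [hx, hy]; rfl
  have hK : a * x + b * y = 0 ∧ c * x + d * y = 0 := by
    have h1 := hM (x, y) hv
    have e : (x ^ 2 + y ^ 2) • (a * x + b * y, c * x + d * y)
        = ((a * x + b * y) * x + (c * x + d * y) * y) • (x, y) := by
      ext
      · simp; linear_combination (- y) * h
      · simp; linear_combination x * h
    have e2 := congrArg (fderiv ℝ φ (x, y)) e
    rw [map_smul, map_smul, euler φ hom _ (hd _ hv)] at e2
    simp only at h1
    rw [h1] at e2
    simp only [smul_eq_mul, mul_zero] at e2
    have e3 := (mul_eq_zero.1 e2.symm).resolve_right (pos _ hv).ne'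
    constructor
    · refine (mul_eq_zero.1 (?_ : (x ^ 2 + y ^ 2) * _ = 0)).resolve_left hs
      linear_combination (- y) * h + x * e3
    · refine (mul_eq_zero.1 (?_ : (x ^ 2 + y ^ 2) * _ = 0)).resolve_left hs
      linear_combination x * h + y * e3
  obtain ⟨k1, k2⟩ := hK
  have hu := core_degen φ pos hom sub hd x y hv (a * y - b * x, c * y - d * x) (by
    intro v hv
    have e : (y * v.1 - x * v.2) • (a * y - b * x, c * y - d * x)
      = (x ^ 2 + y ^ 2) • (a * v.1 + b * v.2, c * v.1 + d * v.2) := by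
      ext
      · simp; linear_combination (- x * v.1 - y * v.2) * k1
      · simp; linear_combination (- x * v.1 - y * v.2) * k2
    rw [e, map_smul, hM v hv, smul_zero])
  rw [Prod.mk_eq_zero] at hu
  obtain ⟨u1, u2⟩ := hu
  refine ⟨?_, ?_, ?_, ?_⟩ <;> refine (mul_eq_zero.1 (?_ : (x ^ 2 + y ^ 2) * _ = 0)).resolve_left hs
  · linear_combination x * k1 + y * u1
  · linear_combination y * k1 - x * u1
  · linear_combination x * k2 + y * u2
  · linear_combination y * k2 - x * u2

lemma quad_factor (x y p1 p2 p3 : ℝ) (h0 : x ^ 2 + y ^ 2 ≠ 0)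
    (h : p1 * x ^ 2 + p2 * (x * y) + p3 * y ^ 2 = 0) :
    ∃ m n : ℝ, p1 = y * m ∧ p2 = y * n - x * m ∧ p3 = - x * n := by
  by_cases hy : y = 0
  · subst hy
    have hx : x ≠ 0 := by rintro rfl; simp at h0
    have : p1 = 0 := by
      have : p1 * x ^ 2 = 0 := by linear_combination h
      exact (mul_eq_zero.1 this).resolve_right (pow_ne_zero 2 hx)
    refine ⟨- p2 / x, - p3 / x, ?_, ?_, ?_⟩ <;> field_simp <;> simp [this]
  · refine ⟨p1 / y, (p2 + x * p1 / y) / y, ?_, ?_, ?_⟩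
    · field_simp
    · field_simp; ring
    · field_simp; linear_combination h

lemma cubic_zero (f : ℝ × ℝ → ℝ) (hf : Continuous f) (hodd : ∀ v, f (-v) = - f v) :
    ∃ v, v ≠ 0 ∧ f v = 0 := by
  set g : ℝ → ℝ := fun t => f (Real.cos t, Real.sin t) with hg
  have hgc : Continuous g := by fun_prop
  have h1 : g Real.pi = - g 0 := by
    simp only [hg]
    rw [← hodd]
    simp
  have : (0 : ℝ) ∈ Set.uIcc (g 0) (g Real.pi) := by
    rw [h1, Set.mem_uIcc]
    rcases le_total 0 (g 0) with h | h
    · right; constructor <;> linarith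
    · left; constructor <;> linarith
  obtain ⟨t, -, ht⟩ := intermediate_value_uIcc hgc.continuousOn this
  refine ⟨(Real.cos t, Real.sin t), ?_, ht⟩
  intro h
  rw [Prod.mk_eq_zero] at h
  have := Real.sin_sq_add_cos_sq t
  rw [h.1, h.2] at this
  simp at this

lemma core_quad (φ : ℝ × ℝ → ℝ) (pos : ∀ v, v ≠ 0 → 0 < φ v)
    (hom : ∀ t : ℝ, 0 ≤ t → ∀ v, φ (t • v) = t * φ v)
    (sub : ∀ v w, φ (v + w) ≤ φ v + φ w)
    (hd : ContDiffOn ℝ 1 φ {0}ᶜ) (p1 p2 p3 q1 q2 q3 : ℝ)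
    (hM : ∀ v : ℝ × ℝ, v ≠ 0 → fderiv ℝ φ v (p1 * v.1 ^ 2 + p2 * (v.1 * v.2) + p3 * v.2 ^ 2,
      q1 * v.1 ^ 2 + q2 * (v.1 * v.2) + q3 * v.2 ^ 2) = 0)
    (hne : ¬ ∃ A B C : ℝ, ∀ v : ℝ × ℝ, φ v ^ 2 = A * v.1 ^ 2 + B * (v.1 * v.2) + C * v.2 ^ 2) :
    p1 = 0 ∧ p2 = 0 ∧ p3 = 0 ∧ q1 = 0 ∧ q2 = 0 ∧ q3 = 0 := by
  have hopen : IsOpen ({0}ᶜ : Set (ℝ × ℝ)) := isOpen_compl_singleton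
  have hd' : ∀ v, v ≠ 0 → DifferentiableAt ℝ φ v := fun v hv =>
    (hd.differentiableOn one_ne_zero).differentiableAt (hopen.mem_nhds hv)
  have hcont : ContinuousOn (fderiv ℝ φ) {0}ᶜ := hd.continuousOn_fderiv_of_isOpen hopen le_rfl
  obtain ⟨⟨x, y⟩, hv, h⟩ := cubic_zero (fun v => v.2 * (p1 * v.1 ^ 2 + p2 * (v.1 * v.2) + p3 * v.2 ^ 2)
     - v.1 * (q1 * v.1 ^ 2 + q2 * (v.1 * v.2) + q3 * v.2 ^ 2)) (by fun_prop)
     (by intro v; simp; ring)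
  simp only at h
  have hs : x ^ 2 + y ^ 2 ≠ 0 := by
    intro hc
    apply hv
    have hx : x = 0 := by nlinarith [sq_nonneg x, sq_nonneg y]
    have hy : y = 0 := by nlinarith [sq_nonneg x, sq_nonneg y]
    rw [hx, hy]; rfl
  have hK : p1 * x ^ 2 + p2 * (x * y) + p3 * y ^ 2 = 0 ∧ q1 * x ^ 2 + q2 * (x * y) + q3 * y ^ 2 = 0 := by
    have h1 := hM (x, y) hv
    simp only at h1
    generalize p1 * x ^ 2 + p2 * (x * y) + p3 * y ^ 2 = P at *
    generalize q1 * x ^ 2 + q2 * (x * y) + q3 * y ^ 2 = Q at *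
    have e : (x ^ 2 + y ^ 2) • (P, Q) = (P * x + Q * y) • (x, y) := by
      ext
      · simp; linear_combination y * h
      · simp; linear_combination (-x) * h
    have e2 := congrArg (fderiv ℝ φ (x, y)) e
    rw [map_smul, map_smul, euler φ hom _ (hd' _ hv), h1] at e2
    simp only [smul_eq_mul, mul_zero] at e2
    have e3 := (mul_eq_zero.1 e2.symm).resolve_right (pos _ hv).ne'
    constructor
    · refine (mul_eq_zero.1 (?_ : (x ^ 2 + y ^ 2) * _ = 0)).resolve_left hs
      linear_combination y * h + x * e3
    · refine (mul_eq_zero.1 (?_ : (x ^ 2 + y ^ 2) * _ = 0)).resolve_left hs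
      linear_combination (-x) * h + y * e3
  obtain ⟨a, b, ha1, ha2, ha3⟩ := quad_factor x y p1 p2 p3 hs hK.1
  obtain ⟨c, d, hc1, hc2, hc3⟩ := quad_factor x y q1 q2 q3 hs hK.2
  have hoff : ∀ v : ℝ × ℝ, v ≠ 0 → y * v.1 - x * v.2 ≠ 0 →
      fderiv ℝ φ v (a * v.1 + b * v.2, c * v.1 + d * v.2) = 0 := by
    intro v hv hl
    have h1 := hM v hv
    have e : (p1 * v.1 ^ 2 + p2 * (v.1 * v.2) + p3 * v.2 ^ 2,
      q1 * v.1 ^ 2 + q2 * (v.1 * v.2) + q3 * v.2 ^ 2) =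
      (y * v.1 - x * v.2) • (a * v.1 + b * v.2, c * v.1 + d * v.2) := by
      rw [ha1, ha2, ha3, hc1, hc2, hc3]
      ext <;> simp <;> ring
    rw [e, map_smul, smul_eq_mul] at h1
    exact (mul_eq_zero.1 h1).resolve_left hl
  have hall : ∀ v : ℝ × ℝ, v ≠ 0 →
      fderiv ℝ φ v (a * v.1 + b * v.2, c * v.1 + d * v.2) = 0 := by
    intro v hv
    by_cases hl : y * v.1 - x * v.2 = 0
    swap
    · exact hoff v hv hl
    have hc1 : ContinuousAt (fun v : ℝ × ℝ => fderiv ℝ φ v (a * v.1 + b * v.2, c * v.1 + d * v.2)) v :=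
      (hcont.continuousAt (hopen.mem_nhds hv)).clm_apply (by fun_prop)
    have hc2 : ContinuousAt (fun t : ℝ => v + t • (y, -x)) 0 := by fun_prop
    have hc3 : ContinuousAt (fun t : ℝ => fderiv ℝ φ (v + t • (y, -x))
        (a * (v + t • (y, -x)).1 + b * (v + t • (y, -x)).2, c * (v + t • (y, -x)).1 + d * (v + t • (y, -x)).2)) 0 :=
      ContinuousAt.comp (g := fun v : ℝ × ℝ => fderiv ℝ φ v (a * v.1 + b * v.2, c * v.1 + d * v.2)) (f := fun t : ℝ => v + t • (y, -x)) (x := 0) (by simpa using hc1) hc2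
    have ht := hc3.tendsto.mono_left (nhdsWithin_le_nhds (s := {0}ᶜ))
    have ht2 : Filter.Tendsto (fun t : ℝ => fderiv ℝ φ (v + t • (y, -x))
        (a * (v + t • (y, -x)).1 + b * (v + t • (y, -x)).2, c * (v + t • (y, -x)).1 + d * (v + t • (y, -x)).2))
        (nhdsWithin 0 {0}ᶜ) (nhds 0) := by
      refine tendsto_const_nhds.congr' ?_
      filter_upwards [self_mem_nhdsWithin] with t ht
      have hl2 : y * (v + t • (y, -x)).1 - x * (v + t • (y, -x)).2 ≠ 0 := by
        have : y * (v + t • (y, -x)).1 - x * (v + t • (y, -x)).2 = t * (x ^ 2 + y ^ 2) := by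
          simp; linear_combination hl
        rw [this]
        exact mul_ne_zero ht hs
      refine (hoff _ ?_ hl2).symm
      intro h
      rw [h] at hl2
      simp at hl2
    simpa using tendsto_nhds_unique ht ht2
  obtain ⟨r1, r2, r3, r4⟩ := core_linear φ pos hom sub hd' a b c d hall hne
  subst r1 r2 r3 r4
  simp [ha1, ha2, ha3, hc1, hc2, hc3]

lemma curve_deriv {E H V : Type*} [NormedAddCommGroup E] [NormedSpace ℝ E]
    [NormedAddCommGroup H] [NormedSpace ℝ H] [NormedAddCommGroup V] [NormedSpace ℝ V]
    (L : E → H →L[ℝ] V) (R : E →L[ℝ] H →L[ℝ] V) (hLd : HasFDerivAt L R 0) (h : E) (v : H) :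
    HasDerivAt (fun t : ℝ => L (t • h) v) (R h v) 0 := by
  have h1 : HasDerivAt (fun t : ℝ => t • h) h 0 := by
    simpa using (hasDerivAt_id (0:ℝ)).smul_const h
  have h2 : HasFDerivAt L R ((0:ℝ) • h) := by simpa using hLd
  have h3 : HasDerivAt (fun t : ℝ => L (t • h)) (R h) 0 := h2.comp_hasDerivAt (0:ℝ) h1
  have h4 := h3.clm_apply (hasDerivAt_const (0:ℝ) v)
  simpa using h4

set_option maxHeartbeats 4000000 in
/-- Lemma: `R(h)(v) = 0` when `h(v) = 0`: let `L` be a `C^∞` family of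
`Φ`-isometries `L α : H → H_α` with `L 0` the inclusion, where `Φ|_H` is not Euclidean,
and let `R` be the derivative of `L` at `0`. Then `R(h)(v) = 0` for every `h ∈ H*` and
`v ∈ ker h`. -/
theorem statement10 (V : Type*) [NormedAddCommGroup V] [NormedSpace ℝ V]
    [FiniteDimensional ℝ V] (hdim : Module.finrank ℝ V = 3)
    (Φ : V → ℝ) (hΦ : IsBanachMinkowski Φ)
    (H : Submodule ℝ V) (hHdim : Module.finrank ℝ H = 2)
    (hHnotEucl : ¬ IsEuclideanNorm (fun v : H => Φ (v : V)))
    (ν : V) (hν : ν ∉ H)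
    (U : Set (H →L[ℝ] ℝ)) (hU : U ∈ nhds (0 : H →L[ℝ] ℝ))
    (L : (H →L[ℝ] ℝ) → (H →L[ℝ] V))
    (hLsmooth : ContDiffOn ℝ (⊤ : ℕ∞) L U)
    (hL0 : L 0 = Submodule.subtypeL H)
    (hLker : ∀ α ∈ U, ∀ π : V →ₗ[ℝ] ℝ, (∀ v : H, π (v : V) = α v) → π ν = 1 →
      ∀ v : H, π (L α v) = 0)
    (hLiso : ∀ α ∈ U, ∀ v : H, Φ (L α v) = Φ (v : V)) :
    ∀ h : H →L[ℝ] ℝ, ∀ v : H, h v = 0 → (fderiv ℝ L 0) h v = 0 := by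
  obtain ⟨-, hpos, hhom, hsub, hsmooth, -⟩ := hΦ
  have hopenV : IsOpen ({0}ᶜ : Set V) := isOpen_compl_singleton
  have hΦd : ∀ v : V, v ≠ 0 → DifferentiableAt ℝ Φ v := fun v hv =>
    (hsmooth.differentiableOn (by simp)).differentiableAt (hopenV.mem_nhds hv)
  have h0U : (0 : H →L[ℝ] ℝ) ∈ U := mem_of_mem_nhds hU
  have hLd : HasFDerivAt L (fderiv ℝ L 0) 0 :=
    ((hLsmooth.contDiffAt hU).differentiableAt (by simp)).hasFDerivAt
  set R := fderiv ℝ L 0 with hR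
  -- curve derivative
  have hcurve : ∀ (h : H →L[ℝ] ℝ) (v : H), HasDerivAt (fun t : ℝ => L (t • h) v) (R h v) 0 := by
    intro h v
    exact curve_deriv L R hLd h v
  have hev : ∀ h : H →L[ℝ] ℝ, ∀ᶠ t : ℝ in nhds 0, t • h ∈ U := by
    intro h
    have hc : ContinuousAt (fun t : ℝ => t • h) 0 := by fun_prop
    apply hc.eventually_mem
    simpa using hU
  -- isometry
  have hiso : ∀ (h : H →L[ℝ] ℝ) (v : H), v ≠ 0 → fderiv ℝ Φ (v : V) (R h v) = 0 := by
    intro h v hv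
    have hv' : (v : V) ≠ 0 := by simpa using hv
    have h1 : HasFDerivAt Φ (fderiv ℝ Φ (v : V)) (L ((0:ℝ) • h) v) := by
      simpa [hL0] using (hΦd _ hv').hasFDerivAt
    have h2 : HasDerivAt (fun t : ℝ => Φ (L (t • h) v)) (fderiv ℝ Φ (v : V) (R h v)) 0 :=
      h1.comp_hasDerivAt (0:ℝ) (hcurve h v)
    refine h2.unique ((hasDerivAt_const (0:ℝ) (Φ v)).congr_of_eventuallyEq ?_)
    filter_upwards [hev h] with t ht
    exact hLiso _ ht v
  -- projection
  obtain ⟨f, hf, hfH⟩ := Submodule.exists_le_ker_of_notMem hν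
  obtain ⟨π₀, hπν, hπH⟩ : ∃ π₀ : V →ₗ[ℝ] ℝ, π₀ ν = 1 ∧ ∀ v : H, π₀ (v : V) = 0 := by
    refine ⟨(f ν)⁻¹ • f, by simp [hf], fun v => ?_⟩
    have : f (v : V) = 0 := hfH v.2
    simp [this]
  have hker : H = LinearMap.ker π₀ := by
    apply Submodule.eq_of_le_of_finrank_eq
    · intro v hv
      exact hπH ⟨v, hv⟩
    · have h1 := LinearMap.finrank_range_add_finrank_ker π₀
      have h2 : LinearMap.range π₀ = ⊤ := by
        rw [LinearMap.range_eq_top]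
        intro r
        exact ⟨r • ν, by simp [hπν]⟩
      rw [h2, finrank_top, Module.finrank_self, hdim] at h1
      omega
  let p : V →ₗ[ℝ] H := LinearMap.codRestrict H (LinearMap.id - π₀.smulRight ν) (by
    intro v
    have : ((LinearMap.id - π₀.smulRight ν : V →ₗ[ℝ] V) v) ∈ LinearMap.ker π₀ := by
      simp [hπν]
    rwa [← hker] at this)
  have hp : ∀ v : V, ((p v : H) : V) = v - π₀ v • ν := fun v => rfl
  have hpH : ∀ v : H, p (v : V) = v := by
    intro v
    ext
    rw [hp, hπH]; simp
  have hpν : p ν = 0 := by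
    ext
    rw [hp, hπν]; simp
  have hπR : ∀ (h : H →L[ℝ] ℝ) (v : H), π₀ (R h v) = - h v := by
    intro h v
    have hz : ∀ᶠ t : ℝ in nhds 0, t * h (p (L (t • h) v)) + π₀ (L (t • h) v) = 0 := by
      filter_upwards [hev h] with t ht
      have := hLker _ ht ((t • (h : H →ₗ[ℝ] ℝ)) ∘ₗ p + π₀) (by
        intro v
        simp [hpH, hπH]) (by simp [hpν, hπν]) v
      simpa using this
    have hcv := hcurve h v
    have d1 : HasDerivAt (fun t : ℝ => h (p (L (t • h) v))) (h (p (R h v))) 0 := by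
      have := (LinearMap.toContinuousLinearMap ((h : H →ₗ[ℝ] ℝ) ∘ₗ p)).hasFDerivAt.comp_hasDerivAt (0:ℝ) hcv
      exact this
    have d2 : HasDerivAt (fun t : ℝ => π₀ (L (t • h) v)) (π₀ (R h v)) 0 := by
      have := (LinearMap.toContinuousLinearMap π₀).hasFDerivAt.comp_hasDerivAt (0:ℝ) hcv
      exact this
    have d3 := ((hasDerivAt_id (0:ℝ)).mul d1).add d2
    have d4 := d3.unique ((hasDerivAt_const (0:ℝ) (0:ℝ)).congr_of_eventuallyEq (by
      filter_upwards [hz] with t ht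
      exact ht))
    simp [hL0, hpH] at d4
    linarith
  -- coordinates
  let b : Module.Basis (Fin 2) ℝ H := Module.finBasisOfFinrankEq ℝ H hHdim
  let e1 : H := b 0
  let e2 : H := b 1
  let h1 : H →L[ℝ] ℝ := LinearMap.toContinuousLinearMap (b.coord 0)
  let h2 : H →L[ℝ] ℝ := LinearMap.toContinuousLinearMap (b.coord 1)
  have hvrep : ∀ v : H, v = h1 v • e1 + h2 v • e2 := by
    intro v
    have := b.sum_repr v
    rw [Fin.sum_univ_two] at this
    exact this.symm
  have h11 : h1 e1 = 1 := by simp [h1, e1]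
  have h12 : h1 e2 = 0 := by simp [h1, e2]
  have h21 : h2 e1 = 0 := by simp [h2, e1]
  have h22 : h2 e2 = 1 := by simp [h2, e2]
  clear_value h1 h2 e1 e2 p
  have hhrep : ∀ h : H →L[ℝ] ℝ, h = h e1 • h1 + h e2 • h2 := by
    intro h
    ext v
    conv_lhs => rw [hvrep v]
    simp
    ring
  let JH : ℝ × ℝ →L[ℝ] H := (ContinuousLinearMap.fst ℝ ℝ ℝ).smulRight e1
    + (ContinuousLinearMap.snd ℝ ℝ ℝ).smulRight e2
  have hJH : ∀ v, JH v = v.1 • e1 + v.2 • e2 := fun v => rfl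
  clear_value JH
  have hJ1 : ∀ v, h1 (JH v) = v.1 := by intro v; simp [hJH, h11, h12]
  have hJ2 : ∀ v, h2 (JH v) = v.2 := by intro v; simp [hJH, h21, h22]
  have hJne : ∀ v, v ≠ 0 → JH v ≠ 0 := by
    intro v hv h
    apply hv
    ext
    · rw [← hJ1, h]; simp
    · rw [← hJ2, h]; simp
  let J : ℝ × ℝ →L[ℝ] V := H.subtypeL.comp JH
  have hJ : ∀ v, J v = (JH v : V) := fun v => rfl
  have hJne' : ∀ v, v ≠ 0 → J v ≠ 0 := by
    intro v hv
    rw [hJ]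
    simpa using hJne v hv
  clear_value J
  set φ : ℝ × ℝ → ℝ := fun v => Φ (J v) with hφ
  have hφfd : ∀ v, v ≠ 0 → fderiv ℝ φ v = (fderiv ℝ Φ (J v)).comp J := by
    intro v hv
    exact ((hΦd _ (hJne' v hv)).hasFDerivAt.comp v J.hasFDerivAt).fderiv
  have hφC : ContDiffOn ℝ 1 φ {0}ᶜ := by
    have : ContDiffOn ℝ 1 Φ {0}ᶜ := hsmooth.of_le (by exact_mod_cast le_top)
    exact this.comp J.contDiff.contDiffOn (fun v hv => hJne' v hv)
  have hne : ¬ ∃ A B C : ℝ, ∀ v : ℝ × ℝ, φ v ^ 2 = A * v.1 ^ 2 + B * (v.1 * v.2) + C * v.2 ^ 2 := by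
    rintro ⟨A, B, C, hABC⟩
    apply hHnotEucl
    let Q : QuadraticForm ℝ H := A • QuadraticMap.linMulLin (h1 : H →ₗ[ℝ] ℝ) (h1 : H →ₗ[ℝ] ℝ)
      + B • QuadraticMap.linMulLin (h1 : H →ₗ[ℝ] ℝ) (h2 : H →ₗ[ℝ] ℝ)
      + C • QuadraticMap.linMulLin (h2 : H →ₗ[ℝ] ℝ) (h2 : H →ₗ[ℝ] ℝ)
    have hQ : ∀ v : H, Φ (v : V) ^ 2 = Q v := by
      intro v
      have := hABC (h1 v, h2 v)
      simp only [hφ, hJ, hJH] at this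
      rw [← hvrep v] at this
      rw [this]
      simp [Q]
      ring
    refine ⟨Q, ?_, hQ⟩
    intro v hv
    rw [← hQ]
    have : (v : V) ≠ 0 := by simpa using hv
    exact pow_pos (hpos _ this) 2
  let r : (H →L[ℝ] ℝ) → H → H := fun h v => p (R h v)
  have hr : ∀ v : ℝ × ℝ, p (R (v.2 • h1 - v.1 • h2) (JH v)) =
      v.2 • (v.1 • p (R h1 e1) + v.2 • p (R h1 e2)) - v.1 • (v.1 • p (R h2 e1) + v.2 • p (R h2 e2)) := by
    intro v
    rw [hJH]
    simp
  have hkey := core_quad φ (fun v hv => hpos _ (hJne' v hv))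
    (fun t ht v => by simp only [hφ, map_smul]; exact hhom t ht _)
    (fun v w => by simp only [hφ, map_add]; exact hsub _ _) hφC
    (- h1 (p (R h2 e1))) (h1 (p (R h1 e1)) - h1 (p (R h2 e2))) (h1 (p (R h1 e2)))
    (- h2 (p (R h2 e1))) (h2 (p (R h1 e1)) - h2 (p (R h2 e2))) (h2 (p (R h1 e2)))
    (by
      intro v hv
      rw [hφfd v hv]
      have hz : π₀ (R (v.2 • h1 - v.1 • h2) (JH v)) = 0 := by
        rw [hπR]
        simp [hJ1, hJ2]
        ring
      have e := hiso (v.2 • h1 - v.1 • h2) (JH v) (hJne v hv)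
      rw [hJ, ContinuousLinearMap.comp_apply, ← e]
      congr 1
      rw [hJ]
      have e3 : ((p (R (v.2 • h1 - v.1 • h2) (JH v)) : H) : V) = R (v.2 • h1 - v.1 • h2) (JH v) := by
        rw [hp, hz]; simp
      rw [← e3]
      congr 1
      rw [hvrep (p (R (v.2 • h1 - v.1 • h2) (JH v))), hr, hJH]
      congr 2
      · simp; ring
      · simp; ring)
    hne
  obtain ⟨z1, z2, z3, z4, z5, z6⟩ := hkey
  have hW : ∀ v : ℝ × ℝ, p (R (v.2 • h1 - v.1 • h2) (JH v)) = 0 := by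
    intro v
    rw [hvrep (p (R (v.2 • h1 - v.1 • h2) (JH v))), hr]
    have k1 : h1 (v.2 • (v.1 • p (R h1 e1) + v.2 • p (R h1 e2)) - v.1 • (v.1 • p (R h2 e1) + v.2 • p (R h2 e2))) = 0 := by
      simp
      linear_combination v.1 ^ 2 * z1 + v.1 * v.2 * z2 + v.2 ^ 2 * z3
    have k2 : h2 (v.2 • (v.1 • p (R h1 e1) + v.2 • p (R h1 e2)) - v.1 • (v.1 • p (R h2 e1) + v.2 • p (R h2 e2))) = 0 := by
      simp
      linear_combination v.1 ^ 2 * z4 + v.1 * v.2 * z5 + v.2 ^ 2 * z6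
    rw [k1, k2]
    simp
  intro h v hhv
  by_cases hv : v = 0
  · rw [hv, map_zero]
  have hJv : JH (h1 v, h2 v) = v := by rw [hJH]; exact (hvrep v).symm
  have hs : h1 v ^ 2 + h2 v ^ 2 ≠ 0 := by
    intro hc
    apply hv
    have hx : h1 v = 0 := by nlinarith [sq_nonneg (h1 v), sq_nonneg (h2 v)]
    have hy : h2 v = 0 := by nlinarith [sq_nonneg (h1 v), sq_nonneg (h2 v)]
    rw [hvrep v, hx, hy]; simp
  have hlin : h e1 * h1 v + h e2 * h2 v = 0 := by
    rw [hvrep v] at hhv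
    simpa [mul_comm] using hhv
  have hc : (h1 v ^ 2 + h2 v ^ 2) • h = (h e1 * h2 v - h e2 * h1 v) • (h2 v • h1 - h1 v • h2) := by
    conv_lhs => rw [hhrep h]
    ext w
    simp
    linear_combination (h1 v * h1 w + h2 v * h2 w) * hlin
  have hWv := hW (h1 v, h2 v)
  rw [hJv] at hWv
  simp only at hWv
  have hRz : (h1 v ^ 2 + h2 v ^ 2) • p (R h v) = 0 := by
    have : p (R ((h1 v ^ 2 + h2 v ^ 2) • h) v) = 0 := by
      rw [hc, map_smul, _root_.smul_apply, map_smul, hWv, smul_zero]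
    simpa using this
  have hpz : p (R h v) = 0 := (smul_eq_zero.1 hRz).resolve_left hs
  have hfin := hp (R h v)
  rw [hpz, hπR, hhv] at hfin
  simpa using hfin.symm
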